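/- arXiv:1002.0306 — 6 statements merged into one kernel-verified Lean document; each statement's English description precedes it below -/
import Mathlib

section
/- For every smooth compactly supported function φ : ℝ^d → ℝ there exist smooth compactly supported functions ψ₁, ψ₂ : ℝ^d → ℝ such that φ = ψ₁² − ψ₂². -/
/-- Every smooth compactly supported function `φ : ℝ^d → ℝ` can be written as the
difference of squares `ψ₁² − ψ₂²` of two smooth compactly supported functions. -/
theorem stmt_1 (d : ℕ) (φ : (Fin d → ℝ) → ℝ)
    (hφ_smooth : ContDiff ℝ (⊤ : ℕ∞) φ) (hφ_supp : HasCompactSupport φ) :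
    ∃ ψ₁ ψ₂ : (Fin d → ℝ) → ℝ,
      ContDiff ℝ (⊤ : ℕ∞) ψ₁ ∧ HasCompactSupport ψ₁ ∧
      ContDiff ℝ (⊤ : ℕ∞) ψ₂ ∧ HasCompactSupport ψ₂ ∧
      ∀ x, φ x = ψ₁ x ^ 2 - ψ₂ x ^ 2 := by
  obtain ⟨R, hR, hsub⟩ :=
    hφ_supp.isCompact.isBounded.subset_closedBall_lt 0 (0 : Fin d → ℝ)
  let χ : ContDiffBump (0 : Fin d → ℝ) := ⟨R, R + 1, hR, lt_add_one R⟩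
  have hχ_smooth : ContDiff ℝ (⊤ : ℕ∞) χ := χ.contDiff
  have hχ_supp : HasCompactSupport χ := χ.hasCompactSupport
  have hmul (x : Fin d → ℝ) : φ x * χ x = φ x := by
    by_cases hx : x ∈ tsupport φ
    · rw [χ.one_of_mem_closedBall (hsub hx), mul_one]
    · rw [image_eq_zero_of_notMem_tsupport hx, zero_mul]
  -- Polarization: `φ = φ * χ = ((φ + χ) / 2) ^ 2 - ((φ - χ) / 2) ^ 2`.
  refine ⟨fun x ↦ (φ x + χ x) / 2, fun x ↦ (φ x - χ x) / 2,
    (hφ_smooth.add hχ_smooth).div_const 2,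
    (hφ_supp.add hχ_supp).comp_left (g := (· / 2)) (zero_div 2),
    (hφ_smooth.sub hχ_smooth).div_const 2,
    (hφ_supp.sub hχ_supp).comp_left (g := (· / 2)) (zero_div 2), fun x ↦ ?_⟩
  linear_combination -hmul x
end

section
/- Let t₀ > 0 and let F, A, G : [0, t₀] → Matrix (Fin d) (Fin d) ℝ be continuous maps with A(t) symmetric positive semidefinite for every t. Let W : [0, t₀] → Matrix (Fin d) (Fin d) ℝ be a differentiable map with W(t) symmetric for every t, satisfying W'(t) = F(t) W(t) + W(t) F(t)ᵀ − 2 W(t) A(t) W(t) + G(t) G(t)ᵀ on [0, t₀], and with W(0) positive definite. Then W(t) is positive definite for every t ∈ [0, t₀]. -/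
open Matrix

namespace Matrix

variable {n : Type*} [Fintype n]

section Jacobi

variable [DecidableEq n]

/-- Jacobi's formula: the derivative of `det M` is `tr (adj M * M')`. -/
theorem hasDerivWithinAt_det {M : ℝ → Matrix n n ℝ} {M' : Matrix n n ℝ} {s : Set ℝ} {t : ℝ}
    (hM : ∀ i j, HasDerivWithinAt (fun u => M u i j) (M' i j) s t) :
    HasDerivWithinAt (fun u => (M u).det) (trace (adjugate (M t) * M')) s t := by
  have hsum : HasDerivWithinAt (fun u => (M u).det)
      (∑ σ : Equiv.Perm n, ((Equiv.Perm.sign σ : ℤ) : ℝ) *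
        ∑ i, (∏ j ∈ Finset.univ.erase i, M t (σ j) j) • M' (σ i) i) s t := by
    simp only [det_apply']
    exact HasDerivWithinAt.fun_sum fun σ _ =>
      (HasDerivWithinAt.fun_finsetProd fun i _ => hM (σ i) i).const_mul _
  convert hsum using 1
  have hdiag : ∀ i, (adjugate (M t) * M') i i = ((M t).updateCol i fun k => M' k i).det := by
    intro i
    rw [← cramer_apply, cramer_eq_adjugate_mulVec]
    rfl
  simp only [trace, diag_apply, hdiag, det_apply', Finset.mul_sum]
  rw [Finset.sum_comm]
  refine Finset.sum_congr rfl fun σ _ => Finset.sum_congr rfl fun i _ => ?_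
  rw [← Finset.mul_prod_erase _ _ (Finset.mem_univ i), updateCol_self, smul_eq_mul,
    mul_comm (M' (σ i) i)]
  congr 2
  refine Finset.prod_congr rfl fun j hj => ?_
  rw [updateCol_ne (Finset.ne_of_mem_erase hj)]

theorem PosDef.posSemidef_adjugate {M : Matrix n n ℝ} (hM : M.PosDef) :
    (adjugate M).PosSemidef := by
  have h : adjugate M = M.det • M⁻¹ := by
    rw [inv_def, smul_smul, Ring.mul_inverse_cancel _ hM.det_pos.ne'.isUnit, one_smul]
  rw [h]
  exact hM.inv.posSemidef.smul hM.det_pos.le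

/-- The adjugate form of the bound `tr (W' W⁻¹) ≥ 2 tr F - 2 tr (A W)` for a Riccati equation. -/
theorem PosDef.det_mul_le_trace_adjugate_mul_riccati {W : Matrix n n ℝ} (hW : W.PosDef)
    (F A G : Matrix n n ℝ) :
    W.det * (2 * trace F - 2 * trace (A * W)) ≤
      trace (adjugate W * (F * W + W * Fᵀ - (2 : ℝ) • (W * A * W) + G * Gᵀ)) := by
  have hG : 0 ≤ trace (adjugate W * (G * Gᵀ)) := by
    rw [← Matrix.mul_assoc, trace_mul_comm, ← Matrix.mul_assoc]
    exact (hW.posSemidef_adjugate.conjTranspose_mul_mul_same G).trace_nonneg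
  have h₁ : trace (adjugate W * (F * W)) = W.det * trace F := by
    rw [← Matrix.mul_assoc, trace_mul_comm, ← Matrix.mul_assoc, mul_adjugate]
    simp
  have h₂ : trace (adjugate W * (W * Fᵀ)) = W.det * trace F := by
    rw [← Matrix.mul_assoc, adjugate_mul]
    simp
  have h₃ : trace (adjugate W * (W * A * W)) = W.det * trace (A * W) := by
    rw [Matrix.mul_assoc, ← Matrix.mul_assoc, adjugate_mul]
    simp
  rw [Matrix.mul_add, Matrix.mul_sub, Matrix.mul_add, mul_smul_comm, trace_add, trace_sub,
    trace_add, trace_smul, h₁, h₂, h₃, smul_eq_mul]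
  linarith

end Jacobi

theorem IsSymm.exists_mem_sphere_of_not_posDef {M : Matrix n n ℝ} (hM : M.IsSymm)
    (h : ¬ M.PosDef) : ∃ x ∈ Metric.sphere (0 : n → ℝ) 1, x ⬝ᵥ M *ᵥ x ≤ 0 := by
  by_contra! hx
  refine h (.of_dotProduct_mulVec_pos hM fun y hy => ?_)
  have hy' : 0 < ‖y‖ := norm_pos_iff.mpr hy
  have := hx (‖y‖⁻¹ • y) (by simp [norm_smul, hy'.ne'])
  rw [mulVec_smul, smul_dotProduct, dotProduct_smul, smul_smul, smul_eq_mul] at this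
  exact pos_of_mul_pos_right this (by positivity)

/-- A continuous path of symmetric matrices that starts positive definite but does not remain so
has a first exit time from the positive definite cone, at which it is positive semidefinite. -/
theorem exists_first_not_posDef {W : ℝ → Matrix n n ℝ} {a b : ℝ}
    (hW : ContinuousOn W (Set.Icc a b)) (hsymm : ∀ t ∈ Set.Icc a b, (W t).IsSymm)
    (ha : (W a).PosDef) (hex : ∃ t ∈ Set.Icc a b, ¬ (W t).PosDef) :
    ∃ τ ∈ Set.Ioc a b, (∀ t ∈ Set.Ico a τ, (W t).PosDef) ∧ (W τ).PosSemidef ∧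
      ¬ (W τ).PosDef := by
  have hcont : ContinuousOn (fun p : ℝ × (n → ℝ) => p.2 ⬝ᵥ W p.1 *ᵥ p.2)
      (Set.Icc a b ×ˢ Metric.sphere 0 1) := by
    have h : Continuous fun q : Matrix n n ℝ × (n → ℝ) => q.2 ⬝ᵥ q.1 *ᵥ q.2 := by fun_prop
    exact h.comp_continuousOn
      ((hW.comp continuousOn_fst fun p hp => hp.1).prodMk continuousOn_snd)
  have hcpt : IsCompact (Set.Icc a b ×ˢ Metric.sphere (0 : n → ℝ) 1) :=
    isCompact_Icc.prod (isCompact_sphere 0 1)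
  have hK : IsCompact ((Set.Icc a b ×ˢ Metric.sphere (0 : n → ℝ) 1) ∩
      (fun p : ℝ × (n → ℝ) => p.2 ⬝ᵥ W p.1 *ᵥ p.2) ⁻¹' Set.Iic 0) :=
    hcpt.of_isClosed_subset (hcont.preimage_isClosed_of_isClosed hcpt.isClosed isClosed_Iic)
      Set.inter_subset_left
  have himage : Prod.fst '' ((Set.Icc a b ×ˢ Metric.sphere (0 : n → ℝ) 1) ∩
      (fun p : ℝ × (n → ℝ) => p.2 ⬝ᵥ W p.1 *ᵥ p.2) ⁻¹' Set.Iic 0) =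
      {t ∈ Set.Icc a b | ¬ (W t).PosDef} := by
    ext t
    constructor
    · rintro ⟨⟨t, x⟩, ⟨⟨ht, hx⟩, hle⟩, rfl⟩
      refine ⟨ht, fun hpos => ?_⟩
      exact (hpos.dotProduct_mulVec_pos (ne_zero_of_mem_unit_sphere ⟨x, hx⟩)).not_ge hle
    · rintro ⟨ht, hpos⟩
      obtain ⟨x, hx, hle⟩ := (hsymm t ht).exists_mem_sphere_of_not_posDef hpos
      exact ⟨(t, x), ⟨⟨ht, hx⟩, hle⟩, rfl⟩
  have hbad := hK.image continuous_fst
  rw [himage] at hbad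
  obtain ⟨τ, ⟨hτ, hτbad⟩, hτmin⟩ := hbad.exists_isLeast hex
  have haτ : a < τ := lt_of_le_of_ne hτ.1 fun h => hτbad (h ▸ ha)
  have hbefore : ∀ t ∈ Set.Ico a τ, (W t).PosDef := fun t ht => by
    by_contra hpos
    exact (hτmin ⟨⟨ht.1, ht.2.le.trans hτ.2⟩, hpos⟩).not_gt ht.2
  refine ⟨τ, ⟨haτ, hτ.2⟩, hbefore,
    .of_dotProduct_mulVec_nonneg (hsymm τ hτ) fun x => ?_, hτbad⟩
  have hx : ContinuousOn (fun t => x ⬝ᵥ W t *ᵥ x) (Set.Icc a τ) := by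
    have h : Continuous fun M : Matrix n n ℝ => x ⬝ᵥ M *ᵥ x := by fun_prop
    exact h.comp_continuousOn (hW.mono (Set.Icc_subset_Icc_right hτ.2))
  rw [← closure_Ico haτ.ne] at hx
  have hmem : τ ∈ closure (Set.Ico a τ) := by
    rw [closure_Ico haτ.ne]
    exact ⟨haτ.le, le_rfl⟩
  exact le_on_closure (f := fun _ => (0 : ℝ))
    (fun t ht => (hbefore t ht).posSemidef.dotProduct_mulVec_nonneg x) continuousOn_const hx hmem

end Matrix

/-- If the symmetric solution `W` of the matrix Riccati equation
`W' = F W + W Fᵀ − 2 W A W + G Gᵀ` on `[0, t₀]`, with continuous coefficients and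
`A(t)` symmetric positive semidefinite, starts at a positive definite matrix `W(0)`,
then `W(t)` stays positive definite on all of `[0, t₀]`. -/
theorem stmt_6 (d : ℕ) (t₀ : ℝ) (ht₀ : 0 < t₀)
    (F A G W : ℝ → Matrix (Fin d) (Fin d) ℝ)
    (hF : ContinuousOn F (Set.Icc 0 t₀))
    (hA : ContinuousOn A (Set.Icc 0 t₀))
    (hG : ContinuousOn G (Set.Icc 0 t₀))
    (hApsd : ∀ t ∈ Set.Icc (0:ℝ) t₀, (A t).PosSemidef)
    (hWsymm : ∀ t ∈ Set.Icc (0:ℝ) t₀, (W t).IsSymm)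
    (hW : ∀ t ∈ Set.Icc (0:ℝ) t₀, ∀ i j, HasDerivWithinAt (fun s => W s i j)
      ((F t * W t + W t * (F t)ᵀ - (2:ℝ) • (W t * A t * W t) + G t * (G t)ᵀ) i j)
      (Set.Icc 0 t₀) t)
    (hW0 : (W 0).PosDef) :
    ∀ t ∈ Set.Icc (0:ℝ) t₀, (W t).PosDef := by
  have hWcont : ContinuousOn W (Set.Icc 0 t₀) :=
    continuousOn_pi.mpr fun i => continuousOn_pi.mpr fun j t ht => (hW t ht i j).continuousWithinAt
  by_contra! hex
  obtain ⟨τ, hτ, hpos, hpsd, hbad⟩ := exists_first_not_posDef hWcont hWsymm hW0 hex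
  have hsub : Set.Icc 0 τ ⊆ Set.Icc 0 t₀ := Set.Icc_subset_Icc_right hτ.2
  have hcoef : ContinuousOn (fun t => 2 * trace (F t) - 2 * trace (A t * W t))
      (Set.Icc 0 t₀) := by
    have h : Continuous fun q : Matrix (Fin d) (Fin d) ℝ × Matrix (Fin d) (Fin d) ℝ ×
        Matrix (Fin d) (Fin d) ℝ => 2 * trace q.1 - 2 * trace (q.2.1 * q.2.2) := by fun_prop
    exact h.comp_continuousOn (hF.prodMk (hA.prodMk hWcont))
  obtain ⟨c, hc⟩ := (isCompact_Icc.image_of_continuousOn hcoef).bddBelow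
  have hdet : ∀ t ∈ Set.Icc (0 : ℝ) t₀, HasDerivWithinAt
      (fun s => (W s).det * Real.exp (-c * s)) _ (Set.Icc 0 t₀) t := fun t ht =>
    (hasDerivWithinAt_det (hW t ht)).mul (((hasDerivAt_id t).const_mul (-c)).exp.hasDerivWithinAt)
  have hmono := monotoneOn_of_hasDerivWithinAt_nonneg (convex_Icc 0 τ)
    (fun t ht => ((hdet t (hsub ht)).continuousWithinAt.mono hsub))
    (fun t ht => (hdet t (hsub (interior_subset ht))).mono (interior_subset.trans hsub))
    (fun t ht => by
      have htI := hsub (interior_subset ht)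
      rw [interior_Icc] at ht
      have hWt := hpos t ⟨ht.1.le, ht.2⟩
      have h₁ := hWt.det_mul_le_trace_adjugate_mul_riccati (F t) (A t) (G t)
      have h₂ := mul_le_mul_of_nonneg_left (hc (Set.mem_image_of_mem _ htI)) hWt.det_pos.le
      have h₃ := mul_nonneg (sub_nonneg.mpr (h₂.trans h₁)) (Real.exp_pos (-c * t)).le
      simp only [id, mul_one]
      linarith)
  have hle := hmono ⟨le_rfl, hτ.1.le⟩ ⟨hτ.1.le, le_rfl⟩ hτ.1.le
  have h₀ := mul_pos hW0.det_pos (Real.exp_pos (-c * 0))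
  exact hbad (hpsd.posDef_iff_det_ne_zero.mpr
    (pos_of_mul_pos_left (h₀.trans_le hle) (Real.exp_pos _).le).ne')
end

section
/- Let T > 0, K ≥ 0, and let F, A, G : [0, T] → Matrix (Fin d) (Fin d) ℝ be continuous with A(t) symmetric positive semidefinite, ‖F(t)‖_F ≤ K, and ‖G(t)‖_F ≤ K for every t. Let 0 < T' ≤ T and let W : [0, T'] → Matrix (Fin d) (Fin d) ℝ be a differentiable map with W(t) symmetric positive semidefinite for every t, satisfying W'(t) = F(t) W(t) + W(t) F(t)ᵀ − 2 W(t) A(t) W(t) + G(t) G(t)ᵀ on [0, T']. Then tr( W(t)² ) ≤ ( tr( W(0)² ) + K² t ) · e^{(4K + K²) t} for every t ∈ [0, T']. -/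
open Matrix

open scoped MatrixOrder in
theorem Matrix.PosSemidef.trace_mul_nonneg {n : Type*} [Fintype n]
    {M N : Matrix n n ℝ} (hM : M.PosSemidef) (hN : N.PosSemidef) : 0 ≤ trace (M * N) := by
  classical
  obtain ⟨B, rfl⟩ := CStarAlgebra.nonneg_iff_eq_star_mul_self.mp hM.nonneg
  rw [star_eq_conjTranspose, Matrix.mul_assoc, trace_mul_comm]
  exact (hN.mul_mul_conjTranspose_same B).trace_nonneg

section Frobenius

open scoped Matrix.Norms.Frobenius

variable {n : Type*} [Fintype n]

theorem Matrix.frobenius_norm_sq_eq_trace (M : Matrix n n ℝ) :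
    ‖M‖ ^ 2 = trace (M * Mᵀ) := by
  have h : trace (M * Mᵀ) = ∑ i, ∑ j, ‖M i j‖ ^ 2 := by
    simp [trace, mul_apply, sq]
  rw [h, frobenius_norm_def, ← Real.sqrt_eq_rpow, Real.sq_sqrt (by positivity)]
  simp

theorem Matrix.frobenius_norm_eq_sqrt_trace (M : Matrix n n ℝ) :
    ‖M‖ = √(trace (M * Mᵀ)) := by
  rw [← frobenius_norm_sq_eq_trace, Real.sqrt_sq (norm_nonneg M)]

theorem Matrix.trace_mul_le_frobenius_norm_mul (M N : Matrix n n ℝ) :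
    trace (M * N) ≤ ‖M‖ * ‖N‖ := by
  rw [← frobenius_norm_transpose N, frobenius_norm_eq_sqrt_trace, frobenius_norm_eq_sqrt_trace]
  have h := Real.sum_mul_le_sqrt_mul_sqrt Finset.univ
    (fun p : n × n => M p.1 p.2) (fun p => Nᵀ p.1 p.2)
  simpa [Fintype.sum_prod_type, trace, mul_apply, sq] using h

theorem riccati_trace_mul_le [DecidableEq n] {K : ℝ} {F A G W : Matrix n n ℝ}
    (hA : A.PosSemidef) (hW : W.PosSemidef)
    (hF : √(trace (F * Fᵀ)) ≤ K) (hG : √(trace (G * Gᵀ)) ≤ K) :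
    2 * trace ((F * W + W * Fᵀ - (2 : ℝ) • (W * A * W) + G * Gᵀ) * W)
      ≤ (4 * K + K ^ 2) * trace (W ^ 2) + K ^ 2 := by
  rw [← frobenius_norm_eq_sqrt_trace] at hF hG
  have hWT : Wᵀ = W := hW.isHermitian
  have hWW : trace (W ^ 2) = ‖W‖ ^ 2 := by
    rw [frobenius_norm_sq_eq_trace, hWT, sq]
  have hFW : trace (F * W * W) ≤ K * ‖W‖ ^ 2 :=
    calc trace (F * W * W) = trace (F * (W * W)) := by rw [Matrix.mul_assoc]
      _ ≤ ‖F‖ * ‖W * W‖ := trace_mul_le_frobenius_norm_mul _ _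
      _ ≤ K * ‖W‖ ^ 2 := by
        have h := norm_mul_le W W
        rw [← sq ‖W‖] at h
        gcongr
        exact (norm_nonneg F).trans hF
  have hWF : trace (W * Fᵀ * W) = trace (F * W * W) := by
    rw [← trace_transpose]
    simp only [transpose_mul, transpose_transpose, hWT]
    rw [trace_mul_comm]
  have hGW : trace (G * Gᵀ * W) ≤ K ^ 2 * ‖W‖ :=
    calc trace (G * Gᵀ * W) ≤ ‖G * Gᵀ‖ * ‖W‖ := trace_mul_le_frobenius_norm_mul _ _
      _ ≤ K ^ 2 * ‖W‖ := by
        have h := norm_mul_le G Gᵀ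
        rw [frobenius_norm_transpose, ← sq] at h
        gcongr
        exact h.trans (by gcongr)
  have hWAW : 0 ≤ trace (W * A * W * W) := by
    have h := hA.mul_mul_conjTranspose_same W
    rw [hW.isHermitian] at h
    exact h.trace_mul_nonneg hW
  simp only [Matrix.add_mul, Matrix.sub_mul, trace_add, trace_sub, Matrix.smul_mul, trace_smul,
    smul_eq_mul, hWF, hWW]
  nlinarith [mul_nonneg (sq_nonneg K) (sq_nonneg (‖W‖ - 1))]

end Frobenius

theorem Matrix.hasDerivWithinAt_trace_sq {n : Type*} [Fintype n] [DecidableEq n]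
    {W : ℝ → Matrix n n ℝ} {W' : Matrix n n ℝ} {s : Set ℝ} {t : ℝ}
    (h : ∀ i j, HasDerivWithinAt (fun r => W r i j) (W' i j) s t) :
    HasDerivWithinAt (fun r => trace (W r ^ 2)) (2 * trace (W' * W t)) s t := by
  have hsum : HasDerivWithinAt (fun r => ∑ i, ∑ j, W r i j * W r j i)
      (∑ i, ∑ j, (W' i j * W t j i + W t i j * W' j i)) s t :=
    .fun_sum fun i _ => .fun_sum fun j _ => (h i j).mul (h j i)
  convert hsum using 1
  · simp [trace, mul_apply, sq]
  · rw [two_mul]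
    nth_rw 2 [trace_mul_comm]
    simp [trace, mul_apply, Finset.sum_add_distrib]

theorem le_mul_exp_of_hasDerivWithinAt_le {f f' : ℝ → ℝ} {b c ε : ℝ} (hc : 0 ≤ c) (hε : 0 ≤ ε)
    (hf : ∀ t ∈ Set.Icc 0 b, HasDerivWithinAt f (f' t) (Set.Icc 0 b) t)
    (hbound : ∀ t ∈ Set.Icc 0 b, f' t ≤ c * f t + ε) {t : ℝ} (ht : t ∈ Set.Icc 0 b) :
    f t ≤ (f 0 + ε * t) * Real.exp (c * t) := by
  have hderiv : ∀ s ∈ Set.Icc 0 b,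
      HasDerivWithinAt (fun r => f r * Real.exp (-(c * r)) - ε * r)
        (f' s * Real.exp (-(c * s)) + f s * (Real.exp (-(c * s)) * -(c * 1)) - ε * 1)
        (Set.Icc 0 b) s := fun s hs =>
    ((hf s hs).mul (((hasDerivAt_id s).const_mul c).fun_neg.exp.hasDerivWithinAt)).sub
      ((hasDerivAt_id s).const_mul ε).hasDerivWithinAt
  have hanti : AntitoneOn (fun r => f r * Real.exp (-(c * r)) - ε * r) (Set.Icc 0 b) := by
    refine antitoneOn_of_hasDerivWithinAt_nonpos (convex_Icc 0 b)
      (fun s hs => (hderiv s hs).continuousWithinAt)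
      (fun s hs => (hderiv s (interior_subset hs)).mono interior_subset) fun s hs => ?_
    have hs' := interior_subset hs
    have hexp : Real.exp (-(c * s)) ≤ 1 := by
      rw [Real.exp_le_one_iff]
      have := mul_nonneg hc hs'.1
      linarith
    have h1 := mul_le_mul_of_nonneg_right (hbound s hs') (Real.exp_pos (-(c * s))).le
    have h2 := mul_le_mul_of_nonneg_left hexp hε
    linarith
  have h := hanti (Set.left_mem_Icc.mpr (ht.1.trans ht.2)) ht ht.1
  simp only [mul_zero, neg_zero, Real.exp_zero, mul_one, sub_zero] at h
  rw [← div_le_iff₀ (Real.exp_pos _), div_eq_mul_inv, ← Real.exp_neg]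
  linarith

/-- Gronwall-type no-blow-up estimate for the matrix Riccati equation
`W' = F W + W Fᵀ − 2 W A W + G Gᵀ`: if `A(t)` is symmetric positive semidefinite,
the Frobenius norms of `F(t)` and `G(t)` are bounded by `K`, and `W(t)` is symmetric
positive semidefinite on `[0, T']`, then
`tr(W(t)²) ≤ (tr(W(0)²) + K² t) e^{(4K + K²) t}` on `[0, T']`.
Here the Frobenius norm bound `‖M‖_F ≤ K` is written as `√(tr (M Mᵀ)) ≤ K`. -/
theorem stmt_7 (d : ℕ) (T T' K : ℝ) (hT : 0 < T) (hK : 0 ≤ K)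
    (hT'pos : 0 < T') (hT'le : T' ≤ T)
    (F A G W : ℝ → Matrix (Fin d) (Fin d) ℝ)
    (hF : ContinuousOn F (Set.Icc 0 T))
    (hA : ContinuousOn A (Set.Icc 0 T))
    (hG : ContinuousOn G (Set.Icc 0 T))
    (hApsd : ∀ t ∈ Set.Icc (0:ℝ) T, (A t).PosSemidef)
    (hFbd : ∀ t ∈ Set.Icc (0:ℝ) T, Real.sqrt (Matrix.trace (F t * (F t)ᵀ)) ≤ K)
    (hGbd : ∀ t ∈ Set.Icc (0:ℝ) T, Real.sqrt (Matrix.trace (G t * (G t)ᵀ)) ≤ K)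
    (hWpsd : ∀ t ∈ Set.Icc (0:ℝ) T', (W t).PosSemidef)
    (hW : ∀ t ∈ Set.Icc (0:ℝ) T', ∀ i j, HasDerivWithinAt (fun s => W s i j)
      ((F t * W t + W t * (F t)ᵀ - (2:ℝ) • (W t * A t * W t) + G t * (G t)ᵀ) i j)
      (Set.Icc 0 T') t) :
    ∀ t ∈ Set.Icc (0:ℝ) T',
      Matrix.trace ((W t) ^ 2)
        ≤ (Matrix.trace ((W 0) ^ 2) + K ^ 2 * t) * Real.exp ((4 * K + K ^ 2) * t) := by
  intro t ht
  have hsub : Set.Icc 0 T' ⊆ Set.Icc 0 T := Set.Icc_subset_Icc_right hT'le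
  exact le_mul_exp_of_hasDerivWithinAt_le (f := fun s => trace (W s ^ 2)) (by positivity)
    (sq_nonneg K) (fun s hs => hasDerivWithinAt_trace_sq (hW s hs))
    (fun s hs => riccati_trace_mul_le (hApsd s (hsub hs)) (hWpsd s hs) (hFbd s (hsub hs))
      (hGbd s (hsub hs))) ht
end

section
/- Let d ≥ 1, T > 0, δ > 0, ε > 0, K ≥ 0. Let F, A, G : [0, T] → Matrix (Fin d) (Fin d) ℝ be continuous maps such that for every t: A(t) is symmetric with δ ‖x‖² ≤ ⟨x, A(t) x⟩ ≤ δ⁻¹ ‖x‖² for all x ∈ ℝ^d, ‖F(t)‖_F ≤ K, and ‖G(t)‖_F ≤ K. Let W₀ be a real symmetric d×d matrix with ε ‖x‖² ≤ ⟨x, W₀ x⟩ ≤ ε⁻¹ ‖x‖² for all x. Then there exists a unique differentiable map W : [0, T] → Matrix (Fin d) (Fin d) ℝ with W(0) = W₀ satisfying W'(t) = F(t) W(t) + W(t) F(t)ᵀ − 2 W(t) A(t) W(t) + G(t) G(t)ᵀ for all t ∈ [0, T]; moreover W(t) is symmetric for every t, and there exists a constant ε₁ > 0, depending only on d, T, δ,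 ε, K, such that ε₁ ‖x‖² ≤ ⟨x, W(t) x⟩ ≤ ε₁⁻¹ ‖x‖² for all t ∈ [0, T] and x ∈ ℝ^d. -/
open Matrix

section ODE

variable {P E : Type*} [NormedAddCommGroup P] [NormedSpace ℝ P]
  [NormedAddCommGroup E] [NormedSpace ℝ E] [ProperSpace E]

/-- A `C¹` vector field depending on a continuous time-dependent parameter is Lipschitz on closed
balls, uniformly in time. -/
theorem ContDiff.exists_forall_lipschitzOnWith_closedBall {h : P × E → E} (hh : ContDiff ℝ 1 h)
    {p : ℝ → P} {T : ℝ} (hp : ContinuousOn p (Set.Icc 0 T)) (x₀ : E) (r : ℝ) :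
    ∃ L : NNReal, ∀ t ∈ Set.Icc 0 T,
      LipschitzOnWith L (fun v => h (p t, v)) (Metric.closedBall x₀ r) := by
  have hc : IsCompact ((p '' Set.Icc 0 T) ×ˢ Metric.closedBall x₀ r) :=
    (isCompact_Icc.image_of_continuousOn hp).prod (isCompact_closedBall x₀ r)
  obtain ⟨L, hL⟩ := hh.locallyLipschitz.locallyLipschitzOn.exists_lipschitzOnWith_of_compact hc
  refine ⟨L, fun t ht => LipschitzOnWith.of_dist_le_mul fun u hu v hv => ?_⟩
  have := hL.dist_le_mul (p t, u) ⟨Set.mem_image_of_mem p ht, hu⟩ (p t, v)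
    ⟨Set.mem_image_of_mem p ht, hv⟩
  simpa [Prod.dist_eq] using this

/-- Uniqueness on a compact time interval for a `C¹` vector field with a continuous parameter. -/
theorem ContDiff.ode_solution_unique {h : P × E → E} (hh : ContDiff ℝ 1 h)
    {p : ℝ → P} {T : ℝ} (hp : ContinuousOn p (Set.Icc 0 T)) {u v : ℝ → E}
    (hu : ∀ t ∈ Set.Icc 0 T, HasDerivWithinAt u (h (p t, u t)) (Set.Icc 0 T) t)
    (hv : ∀ t ∈ Set.Icc 0 T, HasDerivWithinAt v (h (p t, v t)) (Set.Icc 0 T) t)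
    (h0 : u 0 = v 0) : Set.EqOn u v (Set.Icc 0 T) := by
  have huc : ContinuousOn u (Set.Icc 0 T) := fun t ht => (hu t ht).continuousWithinAt
  have hvc : ContinuousOn v (Set.Icc 0 T) := fun t ht => (hv t ht).continuousWithinAt
  obtain ⟨Ru, hRu⟩ := (isCompact_Icc.image_of_continuousOn huc).isBounded.subset_closedBall 0
  obtain ⟨Rv, hRv⟩ := (isCompact_Icc.image_of_continuousOn hvc).isBounded.subset_closedBall 0
  obtain ⟨L, hL⟩ := hh.exists_forall_lipschitzOnWith_closedBall hp 0 (max Ru Rv)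
  have right_deriv : ∀ {w : ℝ → E} {w' : E} {t : ℝ}, t ∈ Set.Ico 0 T →
      HasDerivWithinAt w w' (Set.Icc 0 T) t → HasDerivWithinAt w w' (Set.Ici t) t :=
    fun {w w' t} ht hw => (hw.mono (Set.Icc_subset_Icc_left ht.1)).mono_of_mem_nhdsWithin
      (Icc_mem_nhdsGE ht.2)
  refine ODE_solution_unique_of_mem_Icc_right (v := fun t w => h (p t, w))
    (s := fun _ => Metric.closedBall 0 (max Ru Rv))
    (fun t ht => hL t (Set.Ico_subset_Icc_self ht)) huc
    (fun t ht => right_deriv ht (hu t (Set.Ico_subset_Icc_self ht)))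
    (fun t ht => ?_) hvc
    (fun t ht => right_deriv ht (hv t (Set.Ico_subset_Icc_self ht)))
    (fun t ht => ?_) h0
  · exact Metric.closedBall_subset_closedBall (le_max_left _ _)
      (hRu (Set.mem_image_of_mem u (Set.Ico_subset_Icc_self ht)))
  · exact Metric.closedBall_subset_closedBall (le_max_right _ _)
      (hRv (Set.mem_image_of_mem v (Set.Ico_subset_Icc_self ht)))

/-- Global existence for a `C¹` vector field with a continuous parameter which vanishes far from
the origin. -/
theorem ContDiff.exists_ode_solution_of_vanishing {h : P × E → E} (hh : ContDiff ℝ 1 h)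
    {p : ℝ → P} {T : ℝ} (hT : 0 ≤ T) (hp : ContinuousOn p (Set.Icc 0 T)) {R : ℝ}
    (hR : ∀ q v, R ≤ ‖v‖ → h (q, v) = 0) (x₀ : E) :
    ∃ u : ℝ → E, u 0 = x₀ ∧
      ∀ t ∈ Set.Icc 0 T, HasDerivWithinAt u (h (p t, u t)) (Set.Icc 0 T) t := by
  have hc : IsCompact ((p '' Set.Icc 0 T) ×ˢ Metric.closedBall (0 : E) R) :=
    (isCompact_Icc.image_of_continuousOn hp).prod (isCompact_closedBall _ _)
  obtain ⟨C, hC⟩ := hc.exists_bound_of_continuousOn hh.continuous.continuousOn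
  have bound : ∀ t ∈ Set.Icc 0 T, ∀ v, ‖h (p t, v)‖ ≤ C.toNNReal := by
    intro t ht v
    rcases le_total R ‖v‖ with hv | hv
    · simp [hR _ v hv]
    · exact (hC (p t, v) ⟨Set.mem_image_of_mem p ht, by simpa using hv⟩).trans
        (Real.le_coe_toNNReal C)
  obtain ⟨L, hL⟩ := hh.exists_forall_lipschitzOnWith_closedBall hp x₀ (C.toNNReal * T.toNNReal)
  have hPL : IsPicardLindelof (fun t v => h (p t, v)) (⟨0, le_rfl, hT⟩ : Set.Icc 0 T) x₀
      (C.toNNReal * T.toNNReal) 0 C.toNNReal L :=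
    { lipschitzOnWith := hL
      continuousOn := fun v _ => hh.continuous.comp_continuousOn (hp.prodMk continuousOn_const)
      norm_le := fun t ht v _ => bound t ht v
      mul_max_le := by simp [hT] }
  exact hPL.exists_eq_forall_mem_Icc_hasDerivWithinAt₀

end ODE

namespace Matrix

variable {n : Type*} [Fintype n]

/-- If a differentiable path of symmetric matrices starts positive definite and its derivative is
positive along its kernel, then it stays positive definite. -/
theorem dotProduct_mulVec_pos_of_deriv_pos {M M' : ℝ → Matrix n n ℝ} {T : ℝ}
    (hd : ∀ t ∈ Set.Icc 0 T, ∀ i j,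
      HasDerivWithinAt (fun s => M s i j) (M' t i j) (Set.Icc 0 T) t)
    (hs : ∀ t ∈ Set.Icc 0 T, (M t).IsSymm)
    (h0 : ∀ x, x ≠ 0 → 0 < x ⬝ᵥ (M 0 *ᵥ x))
    (hpos : ∀ t ∈ Set.Icc 0 T, ∀ x, x ≠ 0 → M t *ᵥ x = 0 → 0 < x ⬝ᵥ (M' t *ᵥ x)) :
    ∀ t ∈ Set.Icc 0 T, ∀ x, x ≠ 0 → 0 < x ⬝ᵥ (M t *ᵥ x) := by
  by_contra! hcon
  obtain ⟨t₁, ht₁, x₁, hx₁, hneg⟩ := hcon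
  have hqd : ∀ x : n → ℝ, ∀ t ∈ Set.Icc 0 T,
      HasDerivWithinAt (fun s => x ⬝ᵥ (M s *ᵥ x)) (x ⬝ᵥ (M' t *ᵥ x)) (Set.Icc 0 T) t := by
    intro x t ht
    simp only [dotProduct, mulVec]
    exact HasDerivWithinAt.fun_sum fun i _ => (HasDerivWithinAt.fun_sum fun j _ =>
      (hd t ht i j).mul_const _).const_mul _
  have hMc : ContinuousOn M (Set.Icc 0 T) :=
    continuousOn_pi.2 fun i => continuousOn_pi.2 fun j t ht => (hd t ht i j).continuousWithinAt
  have hcont : ContinuousOn (fun z : ℝ × (n → ℝ) => z.2 ⬝ᵥ (M z.1 *ᵥ z.2))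
      (Set.Icc 0 T ×ˢ Metric.sphere 0 1) := by
    have : ContinuousOn (fun z : ℝ × (n → ℝ) => M z.1) (Set.Icc 0 T ×ˢ Metric.sphere 0 1) :=
      hMc.comp continuousOn_fst fun z hz => hz.1
    rw [continuousOn_iff_continuous_domRestrict] at this ⊢
    exact (continuous_snd.comp continuous_subtype_val).dotProduct
      (this.matrix_mulVec (continuous_snd.comp continuous_subtype_val))
  have hcompact : IsCompact (Prod.fst '' ((Set.Icc 0 T ×ˢ Metric.sphere (0 : n → ℝ) 1) ∩
      (fun z : ℝ × (n → ℝ) => z.2 ⬝ᵥ (M z.1 *ᵥ z.2)) ⁻¹' Set.Iic 0)) := by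
    refine IsCompact.image ?_ continuous_fst
    have hK : IsCompact (Set.Icc 0 T ×ˢ Metric.sphere (0 : n → ℝ) 1) :=
      isCompact_Icc.prod (isCompact_sphere _ _)
    exact hK.of_isClosed_subset (hcont.preimage_isClosed_of_isClosed hK.isClosed isClosed_Iic)
      Set.inter_subset_left
  have scale : ∀ t, ∀ x : n → ℝ, t ∈ Set.Icc 0 T → x ≠ 0 → x ⬝ᵥ (M t *ᵥ x) ≤ 0 →
      t ∈ Prod.fst '' ((Set.Icc 0 T ×ˢ Metric.sphere (0 : n → ℝ) 1) ∩
      (fun z : ℝ × (n → ℝ) => z.2 ⬝ᵥ (M z.1 *ᵥ z.2)) ⁻¹' Set.Iic 0) := by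
    intro t x ht hx hle
    refine ⟨(t, ‖x‖⁻¹ • x), ⟨⟨ht, ?_⟩, ?_⟩, rfl⟩
    · simp [norm_smul, hx]
    · simp only [Set.mem_preimage, Set.mem_Iic, mulVec_smul, dotProduct_smul, smul_dotProduct,
        smul_eq_mul]
      have : 0 ≤ ‖x‖⁻¹ := by positivity
      exact mul_nonpos_of_nonneg_of_nonpos this (mul_nonpos_of_nonneg_of_nonpos this hle)
  obtain ⟨t₀, ⟨⟨_, x₀⟩, ⟨⟨ht₀, hx₀⟩, hq₀⟩, rfl⟩, hmin⟩ :=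
    hcompact.exists_isLeast ⟨t₁, scale t₁ x₁ ht₁ hx₁ hneg⟩
  simp only [Set.mem_preimage, Set.mem_Iic] at ht₀ hx₀ hq₀ hmin
  rename_i t₀
  have hx₀ : x₀ ≠ 0 := by
    rintro rfl
    simp at hx₀
  have hbefore : ∀ s ∈ Set.Ico 0 t₀, ∀ x, x ≠ 0 → 0 < x ⬝ᵥ (M s *ᵥ x) := by
    intro s hs x hx
    by_contra! hle
    exact absurd (hmin (scale s x ⟨hs.1, hs.2.le.trans ht₀.2⟩ hx hle)) (not_le.2 hs.2)
  have ht₀pos : 0 < t₀ := by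
    refine lt_of_le_of_ne ht₀.1 fun h => ?_
    subst h
    exact absurd (h0 x₀ hx₀) (not_lt.2 hq₀)
  have hsub : Set.Ico 0 t₀ ⊆ Set.Icc 0 T := fun s hs => ⟨hs.1, hs.2.le.trans ht₀.2⟩
  have hne : (nhdsWithin t₀ (Set.Ico 0 t₀)).NeBot := by
    rw [← mem_closure_iff_nhdsWithin_neBot, closure_Ico ht₀pos.ne]
    exact ⟨ht₀.1, le_rfl⟩
  have hnonneg : ∀ x, 0 ≤ x ⬝ᵥ (M t₀ *ᵥ x) := by
    intro x
    rcases eq_or_ne x 0 with rfl | hx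
    · simp
    · exact ge_of_tendsto ((hqd x t₀ ht₀).continuousWithinAt.mono hsub)
        (Filter.eventually_of_mem self_mem_nhdsWithin fun s hs => (hbefore s hs x hx).le)
  have hpsd : (M t₀).PosSemidef :=
    .of_dotProduct_mulVec_nonneg (by simpa [IsHermitian] using (hs t₀ ht₀).eq) (by simpa using hnonneg)
  have hzero : x₀ ⬝ᵥ (M t₀ *ᵥ x₀) = 0 := le_antisymm hq₀ (hnonneg x₀)
  have hker : M t₀ *ᵥ x₀ = 0 := (hpsd.dotProduct_mulVec_zero_iff x₀).1 (by simpa using hzero)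
  have hslope := (hasDerivWithinAt_iff_tendsto_slope' (by simp)).1 ((hqd x₀ t₀ ht₀).mono hsub)
  refine absurd (hpos t₀ ht₀ x₀ hx₀ hker) (not_lt.2 (le_of_tendsto hslope
    (Filter.eventually_of_mem self_mem_nhdsWithin fun s hs => ?_)))
  rw [slope_def_field, hzero, sub_zero]
  exact div_nonpos_of_nonneg_of_nonpos (hbefore s hs x₀ hx₀).le (sub_nonpos.2 hs.2.le)

/-- The right-hand side of the matrix Riccati equation. -/
def riccati (F A G W : Matrix n n ℝ) : Matrix n n ℝ :=
  F * W + W * Fᵀ - (2 : ℝ) • (W * A * W) + G * Gᵀ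

theorem riccati_transpose {F A G W : Matrix n n ℝ} (hA : A.IsSymm) :
    riccati F A G Wᵀ = (riccati F A G W)ᵀ := by
  simp only [riccati, transpose_add, transpose_sub, transpose_smul, transpose_mul,
    transpose_transpose, hA.eq, Matrix.mul_assoc]
  rw [add_comm (F * Wᵀ)]

theorem dotProduct_riccati_mulVec {F A G W : Matrix n n ℝ} (hW : W.IsSymm) {r : ℝ} {x : n → ℝ}
    (hx : W *ᵥ x = r • x) :
    x ⬝ᵥ (riccati F A G W *ᵥ x) =
      2 * r * ((Fᵀ *ᵥ x) ⬝ᵥ x) - 2 * r ^ 2 * (x ⬝ᵥ (A *ᵥ x)) + (Gᵀ *ᵥ x) ⬝ᵥ (Gᵀ *ᵥ x) := by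
  have move : ∀ (B : Matrix n n ℝ) (y : n → ℝ), x ⬝ᵥ (B *ᵥ y) = (Bᵀ *ᵥ x) ⬝ᵥ y := by
    intro B y
    rw [dotProduct_mulVec, mulVec_transpose]
  have hW' : ∀ y : n → ℝ, x ⬝ᵥ (W *ᵥ y) = r * (x ⬝ᵥ y) := by
    intro y
    rw [move, hW.eq, hx, smul_dotProduct, smul_eq_mul]
  simp only [riccati, add_mulVec, sub_mulVec, smul_mulVec, ← mulVec_mulVec, dotProduct_add,
    dotProduct_sub, dotProduct_smul, hx, hW', mulVec_smul, smul_eq_mul]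
  rw [move F x, move G, dotProduct_comm x (Fᵀ *ᵥ x)]
  ring

theorem dotProduct_transpose_mulVec_self_le {F : Matrix n n ℝ} {K : ℝ}
    (hF : √(F * Fᵀ).trace ≤ K) (x : n → ℝ) :
    (Fᵀ *ᵥ x) ⬝ᵥ (Fᵀ *ᵥ x) ≤ K ^ 2 * (x ⬝ᵥ x) := by
  have htr : (F * Fᵀ).trace = ∑ j, ∑ i, F i j ^ 2 := by
    rw [Finset.sum_comm]
    simp [trace, mul_apply, sq]
  have hnn : 0 ≤ (F * Fᵀ).trace := by rw [htr]; positivity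
  have hxx : x ⬝ᵥ x = ∑ i, x i ^ 2 := by simp [dotProduct, sq]
  have hle : (F * Fᵀ).trace ≤ K ^ 2 := (Real.sqrt_le_left ((Real.sqrt_nonneg _).trans hF)).1 hF
  calc (Fᵀ *ᵥ x) ⬝ᵥ (Fᵀ *ᵥ x) = ∑ j, (∑ i, F i j * x i) ^ 2 := by
        simp [dotProduct, mulVec, sq]
    _ ≤ ∑ j, (∑ i, F i j ^ 2) * ∑ i, x i ^ 2 :=
        Finset.sum_le_sum fun j _ => Finset.sum_mul_sq_le_sq_mul_sq _ _ _
    _ = (F * Fᵀ).trace * (x ⬝ᵥ x) := by rw [← Finset.sum_mul, htr, hxx]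
    _ ≤ K ^ 2 * (x ⬝ᵥ x) := by
        have : 0 ≤ x ⬝ᵥ x := by rw [hxx]; positivity
        gcongr

theorem abs_transpose_mulVec_dotProduct_le {F : Matrix n n ℝ} {K : ℝ}
    (hF : √(F * Fᵀ).trace ≤ K) (x : n → ℝ) :
    |(Fᵀ *ᵥ x) ⬝ᵥ x| ≤ K * (x ⬝ᵥ x) := by
  have hK : 0 ≤ K := (Real.sqrt_nonneg _).trans hF
  have hx : 0 ≤ x ⬝ᵥ x := by simpa using dotProduct_star_self_nonneg x
  have hcs : ((Fᵀ *ᵥ x) ⬝ᵥ x) ^ 2 ≤ ((Fᵀ *ᵥ x) ⬝ᵥ (Fᵀ *ᵥ x)) * (x ⬝ᵥ x) := by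
    simpa [dotProduct, sq] using Finset.sum_mul_sq_le_sq_mul_sq Finset.univ (Fᵀ *ᵥ x) x
  refine abs_le_of_sq_le_sq (hcs.trans ?_) (by positivity)
  calc _ ≤ K ^ 2 * (x ⬝ᵥ x) * (x ⬝ᵥ x) := by
        gcongr
        exact dotProduct_transpose_mulVec_self_le hF x
    _ = _ := by ring

theorem IsSymm.abs_apply_le [DecidableEq n] {W : Matrix n n ℝ} (hW : W.IsSymm) {C : ℝ}
    (h : ∀ x, 0 ≤ x ⬝ᵥ (W *ᵥ x) ∧ x ⬝ᵥ (W *ᵥ x) ≤ C * (x ⬝ᵥ x)) (i j : n) : |W i j| ≤ C := by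
  have hdiag : ∀ k, W k k ≤ C := fun k => by simpa using (h (Pi.single k 1)).2
  have hadd := (h (Pi.single i 1 + Pi.single j 1)).1
  have hsub := (h (Pi.single i 1 - Pi.single j 1)).1
  have hij := hW.apply i j
  simp only [mulVec_add, mulVec_sub, add_dotProduct, sub_dotProduct, dotProduct_add,
    dotProduct_sub, mulVec_single_one, single_one_dotProduct, col_apply] at hadd hsub
  rw [abs_le]
  constructor <;> linarith [hdiag i, hdiag j]

/-- Two-sided exponential bounds for symmetric solutions of the Riccati equation whose right-hand
side is damped by a factor with values in `[0, 1]`. -/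
theorem riccati_damped_bounds [DecidableEq n] {T δ ε K : ℝ} (hδ : 0 < δ) (hε : 0 < ε) (hK : 0 ≤ K)
    {F A G W : ℝ → Matrix n n ℝ} {c : ℝ → ℝ} (hc : ∀ t, 0 ≤ c t ∧ c t ≤ 1)
    (hA : ∀ t ∈ Set.Icc 0 T, ∀ x,
      δ * (x ⬝ᵥ x) ≤ x ⬝ᵥ (A t *ᵥ x) ∧ x ⬝ᵥ (A t *ᵥ x) ≤ δ⁻¹ * (x ⬝ᵥ x))
    (hF : ∀ t ∈ Set.Icc 0 T, √(F t * (F t)ᵀ).trace ≤ K)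
    (hG : ∀ t ∈ Set.Icc 0 T, √(G t * (G t)ᵀ).trace ≤ K)
    (hW₀ : ∀ x, ε * (x ⬝ᵥ x) ≤ x ⬝ᵥ (W 0 *ᵥ x) ∧ x ⬝ᵥ (W 0 *ᵥ x) ≤ ε⁻¹ * (x ⬝ᵥ x))
    (hd : ∀ t ∈ Set.Icc 0 T, ∀ i j, HasDerivWithinAt (fun s => W s i j)
      ((c t • riccati (F t) (A t) (G t) (W t)) i j) (Set.Icc 0 T) t)
    (hs : ∀ t ∈ Set.Icc 0 T, (W t).IsSymm) :
    ∀ t ∈ Set.Icc 0 T, ∀ x,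
      ε / 2 * Real.exp (-(2 * K + 2 * δ⁻¹ * ε + 1) * t) * (x ⬝ᵥ x) ≤ x ⬝ᵥ (W t *ᵥ x) ∧
      x ⬝ᵥ (W t *ᵥ x) ≤ (ε⁻¹ + 1) * Real.exp ((2 * K + K ^ 2 + 1) * t) * (x ⬝ᵥ x) := by
  have hpos : ∀ x : n → ℝ, x ≠ 0 → 0 < x ⬝ᵥ x := fun x hx => by
    simpa using dotProduct_star_self_pos_iff.2 hx
  have hexp : ∀ m l t : ℝ, ∀ i j : n, HasDerivWithinAt
      (fun s => ((m * Real.exp (l * s)) • (1 : Matrix n n ℝ)) i j)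
      (((l * (m * Real.exp (l * t))) • (1 : Matrix n n ℝ)) i j) (Set.Icc 0 T) t := by
    intro m l t i j
    have h := ((((hasDerivAt_id t).const_mul l).exp.const_mul m).mul_const
      ((1 : Matrix n n ℝ) i j)).hasDerivWithinAt (s := Set.Icc 0 T)
    simp only [smul_apply, smul_eq_mul]
    refine h.congr_deriv ?_
    simp only [id]
    ring
  have lower : ∀ t ∈ Set.Icc 0 T, ∀ x, x ≠ 0 → 0 < x ⬝ᵥ
      ((W t - (ε / 2 * Real.exp (-(2 * K + 2 * δ⁻¹ * ε + 1) * t)) • 1) *ᵥ x) := by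
    refine dotProduct_mulVec_pos_of_deriv_pos (fun t ht i j => (hd t ht i j).sub (hexp _ _ t i j))
      (fun t ht => (hs t ht).sub (isSymm_one.smul _)) ?_ ?_
    · intro x hx
      have := (hW₀ x).1
      have := mul_pos hε (hpos x hx)
      simp only [mul_zero, Real.exp_zero, sub_mulVec, smul_mulVec, one_mulVec, dotProduct_sub,
        dotProduct_smul, smul_eq_mul]
      linarith
    · intro t ht x hx hker
      have hxx := hpos x hx
      set r := ε / 2 * Real.exp (-(2 * K + 2 * δ⁻¹ * ε + 1) * t) with hr
      have hr0 : 0 < r := by positivity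
      have hrε : r ≤ ε := by
        have h1 : Real.exp (-(2 * K + 2 * δ⁻¹ * ε + 1) * t) ≤ 1 := by
          rw [Real.exp_le_one_iff, neg_mul]
          exact neg_nonpos.2 (mul_nonneg (by positivity) ht.1)
        rw [hr]
        nlinarith
      have hWx : W t *ᵥ x = r • x := by
        simpa [sub_mulVec, smul_mulVec, sub_eq_zero] using hker
      have hq := dotProduct_riccati_mulVec (F := F t) (A := A t) (G := G t) (hs t ht) hWx
      have hFx := (abs_le.1 (abs_transpose_mulVec_dotProduct_le (hF t ht) x)).1
      have hAx := (hA t ht x).2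
      have hGx : 0 ≤ ((G t)ᵀ *ᵥ x) ⬝ᵥ ((G t)ᵀ *ᵥ x) := by
        simpa using dotProduct_star_self_nonneg ((G t)ᵀ *ᵥ x)
      have hge : -(r * ((2 * K + 2 * δ⁻¹ * ε) * (x ⬝ᵥ x))) ≤
          x ⬝ᵥ (riccati (F t) (A t) (G t) (W t) *ᵥ x) := by
        have h1 := mul_le_mul_of_nonneg_left hFx hr0.le
        have h2 := mul_le_mul_of_nonneg_left hAx (sq_nonneg r)
        have h3 : r ^ 2 * (δ⁻¹ * (x ⬝ᵥ x)) ≤ r * ε * (δ⁻¹ * (x ⬝ᵥ x)) := by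
          rw [sq]
          gcongr
        rw [hq]
        linarith
      have hnn : 0 ≤ r * ((2 * K + 2 * δ⁻¹ * ε) * (x ⬝ᵥ x)) := by positivity
      have hcq : -(r * ((2 * K + 2 * δ⁻¹ * ε) * (x ⬝ᵥ x))) ≤
          c t * (x ⬝ᵥ (riccati (F t) (A t) (G t) (W t) *ᵥ x)) := by
        have h1 := mul_le_mul_of_nonneg_left hge (hc t).1
        have h2 := mul_le_mul_of_nonneg_right (hc t).2 hnn
        linarith
      have hrx := mul_pos hr0 hxx
      change 0 < x ⬝ᵥ ((c t • riccati (F t) (A t) (G t) (W t) -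
        (-(2 * K + 2 * δ⁻¹ * ε + 1) * r) • (1 : Matrix n n ℝ)) *ᵥ x)
      simp only [sub_mulVec, smul_mulVec, one_mulVec, dotProduct_sub, dotProduct_smul, smul_eq_mul]
      linarith
  have upper : ∀ t ∈ Set.Icc 0 T, ∀ x, x ≠ 0 → 0 < x ⬝ᵥ
      ((((ε⁻¹ + 1) * Real.exp ((2 * K + K ^ 2 + 1) * t)) • 1 - W t) *ᵥ x) := by
    refine dotProduct_mulVec_pos_of_deriv_pos (fun t ht i j => (hexp _ _ t i j).sub (hd t ht i j))
      (fun t ht => (isSymm_one.smul _).sub (hs t ht)) ?_ ?_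
    · intro x hx
      have := (hW₀ x).2
      have := hpos x hx
      simp only [mul_zero, Real.exp_zero, sub_mulVec, smul_mulVec, one_mulVec, dotProduct_sub,
        dotProduct_smul, smul_eq_mul]
      linarith
    · intro t ht x hx hker
      have hxx := hpos x hx
      set r := (ε⁻¹ + 1) * Real.exp ((2 * K + K ^ 2 + 1) * t) with hr
      have hr1 : 1 ≤ r := by
        have h1 : 1 ≤ Real.exp ((2 * K + K ^ 2 + 1) * t) :=
          Real.one_le_exp (mul_nonneg (by positivity) ht.1)
        have h2 : 0 < ε⁻¹ := by positivity
        rw [hr]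
        nlinarith
      have hr0 : 0 < r := by positivity
      have hWx : W t *ᵥ x = r • x := by
        simpa [sub_mulVec, smul_mulVec, sub_eq_zero, eq_comm] using hker
      have hq := dotProduct_riccati_mulVec (F := F t) (A := A t) (G := G t) (hs t ht) hWx
      have hFx := (abs_le.1 (abs_transpose_mulVec_dotProduct_le (hF t ht) x)).2
      have hAx : 0 ≤ x ⬝ᵥ (A t *ᵥ x) := le_trans (by positivity) (hA t ht x).1
      have hGx := dotProduct_transpose_mulVec_self_le (hG t ht) x
      have hle : x ⬝ᵥ (riccati (F t) (A t) (G t) (W t) *ᵥ x) ≤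
          r * ((2 * K + K ^ 2) * (x ⬝ᵥ x)) := by
        have h1 := mul_le_mul_of_nonneg_left hFx hr0.le
        have h2 := mul_nonneg (sq_nonneg r) hAx
        have h3 : K ^ 2 * (x ⬝ᵥ x) ≤ r * (K ^ 2 * (x ⬝ᵥ x)) :=
          le_mul_of_one_le_left (by positivity) hr1
        rw [hq]
        linarith
      have hnn : 0 ≤ r * ((2 * K + K ^ 2) * (x ⬝ᵥ x)) := by positivity
      have hcq : c t * (x ⬝ᵥ (riccati (F t) (A t) (G t) (W t) *ᵥ x)) ≤
          r * ((2 * K + K ^ 2) * (x ⬝ᵥ x)) := by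
        have h1 := mul_le_mul_of_nonneg_left hle (hc t).1
        have h2 := mul_le_mul_of_nonneg_right (hc t).2 hnn
        linarith
      have hrx := mul_pos hr0 hxx
      change 0 < x ⬝ᵥ (((2 * K + K ^ 2 + 1) * r) • (1 : Matrix n n ℝ) -
        c t • riccati (F t) (A t) (G t) (W t)) *ᵥ x
      simp only [sub_mulVec, smul_mulVec, one_mulVec, dotProduct_sub, dotProduct_smul, smul_eq_mul]
      linarith
  intro t ht x
  rcases eq_or_ne x 0 with rfl | hx
  · simp
  · have h1 := lower t ht x hx
    have h2 := upper t ht x hx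
    simp only [sub_mulVec, smul_mulVec, one_mulVec, dotProduct_sub, dotProduct_smul,
      smul_eq_mul] at h1 h2
    constructor <;> linarith


section Elementwise

open scoped Matrix.Norms.Elementwise

theorem contDiff_riccati : ContDiff ℝ 1
    fun q : (Matrix n n ℝ × Matrix n n ℝ × Matrix n n ℝ) × Matrix n n ℝ =>
      riccati q.1.1 q.1.2.1 q.1.2.2 q.2 := by
  have entry : ∀ i j, ContDiff ℝ 1 fun M : Matrix n n ℝ => M i j := fun i j =>
    contDiff_pi.1 (contDiff_pi.1 contDiff_id i) j
  have hF : ∀ i j, ContDiff ℝ 1 fun q : (Matrix n n ℝ × Matrix n n ℝ × Matrix n n ℝ) ×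
      Matrix n n ℝ => q.1.1 i j := fun i j => (entry i j).comp (by fun_prop)
  have hA : ∀ i j, ContDiff ℝ 1 fun q : (Matrix n n ℝ × Matrix n n ℝ × Matrix n n ℝ) ×
      Matrix n n ℝ => q.1.2.1 i j := fun i j => (entry i j).comp (by fun_prop)
  have hG : ∀ i j, ContDiff ℝ 1 fun q : (Matrix n n ℝ × Matrix n n ℝ × Matrix n n ℝ) ×
      Matrix n n ℝ => q.1.2.2 i j := fun i j => (entry i j).comp (by fun_prop)
  have hW : ∀ i j, ContDiff ℝ 1 fun q : (Matrix n n ℝ × Matrix n n ℝ × Matrix n n ℝ) ×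
      Matrix n n ℝ => q.2 i j := fun i j => (entry i j).comp (by fun_prop)
  refine contDiff_pi.2 fun i => contDiff_pi.2 fun j => ?_
  simp only [riccati, add_apply, sub_apply, smul_apply, mul_apply, transpose_apply, smul_eq_mul]
  fun_prop

theorem hasDerivWithinAt_iff_apply {W : ℝ → Matrix n n ℝ} {W' : Matrix n n ℝ} {s : Set ℝ} {t : ℝ} :
    HasDerivWithinAt W W' s t ↔ ∀ i j, HasDerivWithinAt (fun u => W u i j) (W' i j) s t :=
  hasDerivWithinAt_pi.trans (forall_congr' fun _ => hasDerivWithinAt_pi)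

/-- Uniqueness for the Riccati equation with a continuous scalar factor. -/
theorem riccati_damped_unique {T : ℝ} {F A G U V : ℝ → Matrix n n ℝ} {c : ℝ → ℝ}
    (hc : ContinuousOn c (Set.Icc 0 T)) (hF : ContinuousOn F (Set.Icc 0 T))
    (hA : ContinuousOn A (Set.Icc 0 T)) (hG : ContinuousOn G (Set.Icc 0 T))
    (hU : ∀ t ∈ Set.Icc 0 T, ∀ i j, HasDerivWithinAt (fun s => U s i j)
      ((c t • riccati (F t) (A t) (G t) (U t)) i j) (Set.Icc 0 T) t)
    (hV : ∀ t ∈ Set.Icc 0 T, ∀ i j, HasDerivWithinAt (fun s => V s i j)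
      ((c t • riccati (F t) (A t) (G t) (V t)) i j) (Set.Icc 0 T) t)
    (h0 : U 0 = V 0) : Set.EqOn U V (Set.Icc 0 T) := by
  have hh : ContDiff ℝ 1
      fun q : (ℝ × Matrix n n ℝ × Matrix n n ℝ × Matrix n n ℝ) × Matrix n n ℝ =>
        q.1.1 • riccati q.1.2.1 q.1.2.2.1 q.1.2.2.2 q.2 :=
    (contDiff_fst.comp contDiff_fst).smul (contDiff_riccati.comp
      (f := fun q : (ℝ × Matrix n n ℝ × Matrix n n ℝ × Matrix n n ℝ) × Matrix n n ℝ =>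
        (q.1.2, q.2)) (by fun_prop))
  exact hh.ode_solution_unique (p := fun t => (c t, F t, A t, G t))
    (hc.prodMk (hF.prodMk (hA.prodMk hG)))
    (fun t ht => hasDerivWithinAt_iff_apply.2 (hU t ht))
    (fun t ht => hasDerivWithinAt_iff_apply.2 (hV t ht)) h0

/-- Existence for the Riccati equation damped by a cutoff factor which equals one wherever the
entries of the solution are bounded by `R`. -/
theorem exists_riccati_damped {T : ℝ} (hT : 0 ≤ T) {F A G : ℝ → Matrix n n ℝ}
    (hF : ContinuousOn F (Set.Icc 0 T)) (hA : ContinuousOn A (Set.Icc 0 T))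
    (hG : ContinuousOn G (Set.Icc 0 T)) (W₀ : Matrix n n ℝ) {R : ℝ} (hR : 0 < R) :
    ∃ (W : ℝ → Matrix n n ℝ) (c : ℝ → ℝ), W 0 = W₀ ∧ ContinuousOn c (Set.Icc 0 T) ∧
      (∀ t, 0 ≤ c t ∧ c t ≤ 1) ∧ (∀ t, (∀ i j, |W t i j| ≤ R) → c t = 1) ∧
      ∀ t ∈ Set.Icc 0 T, ∀ i j, HasDerivWithinAt (fun s => W s i j)
        ((c t • riccati (F t) (A t) (G t) (W t)) i j) (Set.Icc 0 T) t := by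
  let χ : ContDiffBump (0 : Matrix n n ℝ) := ⟨R, R + 1, hR, lt_add_one R⟩
  have hh : ContDiff ℝ 1
      fun q : (Matrix n n ℝ × Matrix n n ℝ × Matrix n n ℝ) × Matrix n n ℝ =>
        χ q.2 • riccati q.1.1 q.1.2.1 q.1.2.2 q.2 :=
    (χ.contDiff.comp contDiff_snd).smul contDiff_riccati
  obtain ⟨W, hW0, hW⟩ := hh.exists_ode_solution_of_vanishing hT
    (p := fun t => (F t, A t, G t)) (hF.prodMk (hA.prodMk hG)) (R := R + 1)
    (fun q v hv => by simp [χ.zero_of_le_dist (x := v) (by simpa using hv)]) W₀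
  refine ⟨W, fun t => χ (W t), hW0, ?_, fun t => ⟨χ.nonneg, χ.le_one⟩, fun t ht => ?_,
    fun t ht => hasDerivWithinAt_iff_apply.1 (hW t ht)⟩
  · exact χ.continuous.comp_continuousOn fun t ht => (hW t ht).continuousWithinAt
  · exact χ.one_of_mem_closedBall (mem_closedBall_zero_iff.2 ((norm_le_iff hR.le).2 ht))

end Elementwise

end Matrix

/-- Deterministic core of Lemma 11.1.1: the matrix Riccati equation
`W' = F W + W Fᵀ − 2 W A W + G Gᵀ`, with continuous coefficients, `A(t)` symmetric
and uniformly elliptic with constant `δ`, `‖F(t)‖_F, ‖G(t)‖_F ≤ K`, and symmetric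
initial value `W₀` with `ε‖x‖² ≤ ⟨x, W₀ x⟩ ≤ ε⁻¹‖x‖²`, has a unique solution on
`[0, T]`; the solution is symmetric and satisfies a two-sided bound
`ε₁‖x‖² ≤ ⟨x, W(t) x⟩ ≤ ε₁⁻¹‖x‖²` with `ε₁ > 0` depending only on `d, T, δ, ε, K`. -/
theorem stmt_8 (d : ℕ) (hd : 1 ≤ d) (T δ ε K : ℝ)
    (hT : 0 < T) (hδ : 0 < δ) (hε : 0 < ε) (hK : 0 ≤ K) :
    ∃ ε₁ : ℝ, 0 < ε₁ ∧
      ∀ (F A G : ℝ → Matrix (Fin d) (Fin d) ℝ) (W₀ : Matrix (Fin d) (Fin d) ℝ),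
        ContinuousOn F (Set.Icc 0 T) → ContinuousOn A (Set.Icc 0 T) →
        ContinuousOn G (Set.Icc 0 T) →
        (∀ t ∈ Set.Icc (0:ℝ) T, (A t).IsSymm) →
        (∀ t ∈ Set.Icc (0:ℝ) T, ∀ x : Fin d → ℝ,
          δ * (x ⬝ᵥ x) ≤ x ⬝ᵥ (A t *ᵥ x) ∧ x ⬝ᵥ (A t *ᵥ x) ≤ δ⁻¹ * (x ⬝ᵥ x)) →
        (∀ t ∈ Set.Icc (0:ℝ) T, Real.sqrt (Matrix.trace (F t * (F t)ᵀ)) ≤ K) →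
        (∀ t ∈ Set.Icc (0:ℝ) T, Real.sqrt (Matrix.trace (G t * (G t)ᵀ)) ≤ K) →
        W₀.IsSymm →
        (∀ x : Fin d → ℝ,
          ε * (x ⬝ᵥ x) ≤ x ⬝ᵥ (W₀ *ᵥ x) ∧ x ⬝ᵥ (W₀ *ᵥ x) ≤ ε⁻¹ * (x ⬝ᵥ x)) →
        ∃ W : ℝ → Matrix (Fin d) (Fin d) ℝ,
          W 0 = W₀ ∧
          (∀ t ∈ Set.Icc (0:ℝ) T, ∀ i j, HasDerivWithinAt (fun s => W s i j)
            ((F t * W t + W t * (F t)ᵀ - (2:ℝ) • (W t * A t * W t) + G t * (G t)ᵀ) i j)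
            (Set.Icc 0 T) t) ∧
          (∀ t ∈ Set.Icc (0:ℝ) T, (W t).IsSymm) ∧
          (∀ t ∈ Set.Icc (0:ℝ) T, ∀ x : Fin d → ℝ,
            ε₁ * (x ⬝ᵥ x) ≤ x ⬝ᵥ (W t *ᵥ x) ∧ x ⬝ᵥ (W t *ᵥ x) ≤ ε₁⁻¹ * (x ⬝ᵥ x)) ∧
          (∀ W' : ℝ → Matrix (Fin d) (Fin d) ℝ,
            W' 0 = W₀ →
            (∀ t ∈ Set.Icc (0:ℝ) T, ∀ i j, HasDerivWithinAt (fun s => W' s i j)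
              ((F t * W' t + W' t * (F t)ᵀ - (2:ℝ) • (W' t * A t * W' t) + G t * (G t)ᵀ) i j)
              (Set.Icc 0 T) t) →
            ∀ t ∈ Set.Icc (0:ℝ) T, W' t = W t) := by
  set r := ε / 2 * Real.exp (-(2 * K + 2 * δ⁻¹ * ε + 1) * T)
  set R := (ε⁻¹ + 1) * Real.exp ((2 * K + K ^ 2 + 1) * T)
  have hr : 0 < r := by positivity
  have hR : 0 < R := by positivity
  refine ⟨min r R⁻¹, by positivity, ?_⟩
  intro F A G W₀ hFc hAc hGc hAs hA hF hG hW₀s hW₀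
  obtain ⟨W, c, rfl, hcc, hc, hcR, hW⟩ := exists_riccati_damped hT.le hFc hAc hGc W₀ hR
  have hWs : ∀ t ∈ Set.Icc (0 : ℝ) T, (W t).IsSymm :=
    riccati_damped_unique (U := fun t => (W t)ᵀ) hcc hFc hAc hGc
      (fun t ht i j => by
        rw [riccati_transpose (hAs t ht)]
        exact hW t ht j i) hW hW₀s
  have hx : ∀ x : Fin d → ℝ, 0 ≤ x ⬝ᵥ x := fun x => by
    simpa using dotProduct_star_self_nonneg x
  have hbd : ∀ t ∈ Set.Icc (0 : ℝ) T, ∀ x : Fin d → ℝ,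
      r * (x ⬝ᵥ x) ≤ x ⬝ᵥ (W t *ᵥ x) ∧ x ⬝ᵥ (W t *ᵥ x) ≤ R * (x ⬝ᵥ x) := by
    intro t ht x
    obtain ⟨hl, hu⟩ := riccati_damped_bounds hδ hε hK hc hA hF hG hW₀ hW hWs t ht x
    refine ⟨le_trans ?_ hl, hu.trans ?_⟩
    · refine mul_le_mul_of_nonneg_right (mul_le_mul_of_nonneg_left
        (Real.exp_le_exp.2 ?_) (by positivity)) (hx x)
      rw [neg_mul, neg_mul]
      exact neg_le_neg (mul_le_mul_of_nonneg_left ht.2 (by positivity))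
    · refine mul_le_mul_of_nonneg_right (mul_le_mul_of_nonneg_left
        (Real.exp_le_exp.2 ?_) (by positivity)) (hx x)
      exact mul_le_mul_of_nonneg_left ht.2 (by positivity)
  have hc1 : ∀ t ∈ Set.Icc (0 : ℝ) T, c t = 1 := fun t ht => hcR t fun i j =>
    (hWs t ht).abs_apply_le
      (fun x => ⟨(mul_nonneg hr.le (hx x)).trans (hbd t ht x).1, (hbd t ht x).2⟩) i j
  have hsol : ∀ t ∈ Set.Icc (0 : ℝ) T, ∀ i j, HasDerivWithinAt (fun s => W s i j)
      (riccati (F t) (A t) (G t) (W t) i j) (Set.Icc 0 T) t := fun t ht i j => by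
    simpa [hc1 t ht] using hW t ht i j
  refine ⟨W, rfl, hsol, hWs, fun t ht x => ⟨?_, ?_⟩, fun V hV0 hV => ?_⟩
  · exact (mul_le_mul_of_nonneg_right (min_le_left _ _) (hx x)).trans (hbd t ht x).1
  · refine (hbd t ht x).2.trans (mul_le_mul_of_nonneg_right ?_ (hx x))
    exact (le_inv_comm₀ (by positivity) hR).1 (min_le_right _ _)
  · exact riccati_damped_unique (c := fun _ => 1) continuousOn_const hFc hAc hGc
      (fun t ht i j => by rw [one_smul]; exact hV t ht i j)
      (fun t ht i j => by rw [one_smul]; exact hsol t ht i j) hV0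
end

section
/- Let d ≥ 1, T > 0, 1 ≤ r ≤ q < ∞, ρ₁ ∈ (0, 1], K ≥ 0, and let b : [0, T] × ℝ^d → ℝ be (jointly) measurable. Assume: (i) for every x ∈ ℝ^d the function t ↦ ∫_{B_1(x)} |b(t, y)| dy is finite for all t and belongs to L^r([0, T]); (ii) for every t ∈ [0, T] and every x ∈ ℝ^d, ∫_{B_{ρ₁}(x)} ∫_{B_{ρ₁}(x)} |b(t, y) − b(t, z)|^q dy dz ≤ K. Then for every R > 0 one has ∫_0^T ∫_{B_R} |b(t, x)|^r dx dt < ∞. -/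
open MeasureTheory

open scoped ENNReal Topology

variable {α : Type*} [MeasurableSpace α]

/-- Jensen's inequality for powers and the lower Lebesgue integral. -/
theorem lintegral_rpow_le_measure_univ_rpow_mul {μ : Measure α} {f : α → ℝ≥0∞}
    (hf : AEMeasurable f μ) {r : ℝ} (hr : 1 ≤ r) :
    (∫⁻ x, f x ∂μ) ^ r ≤ μ Set.univ ^ (r - 1) * ∫⁻ x, f x ^ r ∂μ := by
  rcases hr.eq_or_lt with rfl | hr'
  · simp
  have hr0 : 0 < r := one_pos.trans hr'
  have h := ENNReal.lintegral_mul_le_Lp_mul_Lq μ (Real.HolderConjugate.conjExponent hr') hf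
    (aemeasurable_const (b := (1 : ℝ≥0∞)))
  simp only [Pi.mul_apply, mul_one, ENNReal.one_rpow, lintegral_one] at h
  calc (∫⁻ x, f x ∂μ) ^ r
      ≤ ((∫⁻ x, f x ^ r ∂μ) ^ (1 / r) * μ Set.univ ^ (1 / r.conjExponent)) ^ r :=
        ENNReal.rpow_le_rpow h hr0.le
    _ = μ Set.univ ^ (r - 1) * ∫⁻ x, f x ^ r ∂μ := by
        rw [ENNReal.mul_rpow_of_nonneg _ _ hr0.le, ← ENNReal.rpow_mul, ← ENNReal.rpow_mul,
          one_div_mul_cancel hr0.ne', ENNReal.rpow_one, mul_comm]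
        congr 2
        rw [Real.conjExponent]
        field_simp

/-- The `r`-th power integral of `f` is controlled by its `q`-th power mean oscillation and by
its integral. -/
theorem measure_univ_rpow_mul_lintegral_rpow_le {μ : Measure α} [IsFiniteMeasure μ] {f : α → ℝ}
    (hf : Measurable f) {r q : ℝ} (hr : 1 ≤ r) (hrq : r ≤ q) :
    μ Set.univ ^ r * ∫⁻ y, ENNReal.ofReal (|f y| ^ r) ∂μ ≤
      2 ^ (r - 1) * (μ Set.univ ^ (r - 1) *
        (μ Set.univ * μ Set.univ + ∫⁻ y, ∫⁻ z, ENNReal.ofReal (|f y - f z| ^ q) ∂μ ∂μ) +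
        (∫⁻ z, ENNReal.ofReal |f z| ∂μ) ^ r * μ Set.univ) := by
  have hr0 : 0 ≤ r := zero_le_one.trans hr
  set m := μ Set.univ with hm
  have hm_top : m ≠ ∞ := measure_ne_top μ _
  set N := ∫⁻ z, ENNReal.ofReal |f z| ∂μ with hN
  have htri (y : α) : m * ENNReal.ofReal |f y| ≤ (∫⁻ z, ENNReal.ofReal |f y - f z| ∂μ) + N := by
    rw [mul_comm, hm, ← lintegral_const, hN, ← lintegral_add_right _ (by fun_prop)]
    refine lintegral_mono fun z => ?_
    rw [← ENNReal.ofReal_add (abs_nonneg _) (abs_nonneg _)]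
    apply ENNReal.ofReal_le_ofReal
    simpa using abs_add_le (f y - f z) (f z)
  have hosc (y : α) : (∫⁻ z, ENNReal.ofReal |f y - f z| ∂μ) ^ r ≤
      m ^ (r - 1) * (m + ∫⁻ z, ENNReal.ofReal (|f y - f z| ^ q) ∂μ) := by
    refine (lintegral_rpow_le_measure_univ_rpow_mul (by fun_prop) hr).trans ?_
    gcongr
    rw [hm, ← lintegral_one, ← lintegral_add_left (by fun_prop)]
    refine lintegral_mono fun z => ?_
    have h0 := abs_nonneg (f y - f z)
    rw [ENNReal.ofReal_rpow_of_nonneg h0 hr0, ← ENNReal.ofReal_one,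
      ← ENNReal.ofReal_add zero_le_one (by positivity)]
    apply ENNReal.ofReal_le_ofReal
    rcases le_total |f y - f z| 1 with h1 | h1
    · exact (Real.rpow_le_one h0 h1 hr0).trans (le_add_of_nonneg_right (by positivity))
    · exact (Real.rpow_le_rpow_of_exponent_le h1 hrq).trans (le_add_of_nonneg_left zero_le_one)
  have hpt (y : α) : m ^ r * ENNReal.ofReal (|f y| ^ r) ≤ 2 ^ (r - 1) *
      (m ^ (r - 1) * (m + ∫⁻ z, ENNReal.ofReal (|f y - f z| ^ q) ∂μ) + N ^ r) := by
    rw [← ENNReal.ofReal_rpow_of_nonneg (abs_nonneg _) hr0, ← ENNReal.mul_rpow_of_nonneg _ _ hr0]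
    refine (ENNReal.rpow_le_rpow (htri y) hr0).trans ?_
    refine (ENNReal.rpow_add_le_mul_rpow_add_rpow _ _ hr).trans ?_
    gcongr
    exact hosc y
  have hmr : m ^ r ≠ ∞ := ENNReal.rpow_ne_top_of_nonneg hr0 hm_top
  have hmr' : m ^ (r - 1) ≠ ∞ := ENNReal.rpow_ne_top_of_nonneg (by linarith) hm_top
  have h2 : (2 : ℝ≥0∞) ^ (r - 1) ≠ ∞ :=
    ENNReal.rpow_ne_top_of_nonneg (by linarith) ENNReal.ofNat_ne_top
  rw [← lintegral_const_mul' _ _ hmr]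
  refine (lintegral_mono hpt).trans_eq ?_
  rw [lintegral_const_mul' _ _ h2, lintegral_add_right _ measurable_const,
    lintegral_const_mul' _ _ hmr', lintegral_add_left measurable_const, lintegral_const,
    lintegral_const]

/-- Lemma 9.2.1: if the ball averages `t ↦ ∫_{B₁(x)} |b(t,y)| dy` are finite and
belong to `L^r([0,T])` for every `x`, and the `q`-th power mean oscillation of
`b(t,·)` over balls of radius `ρ₁` is uniformly bounded by `K` (with `r ≤ q`),
then `∫_0^T ∫_{B_R} |b(t,x)|^r dx dt < ∞` for every `R > 0`. -/
theorem stmt_11 (d : ℕ) (hd : 1 ≤ d) (T : ℝ) (hT : 0 < T)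
    (r q : ℝ) (hr : 1 ≤ r) (hrq : r ≤ q)
    (ρ₁ : ℝ) (hρ₁ : ρ₁ ∈ Set.Ioc (0:ℝ) 1) (K : ℝ) (hK : 0 ≤ K)
    (b : ℝ → EuclideanSpace ℝ (Fin d) → ℝ)
    (hb : Measurable (Function.uncurry b))
    (hb1 : ∀ x : EuclideanSpace ℝ (Fin d), ∀ t ∈ Set.Icc (0:ℝ) T,
      (∫⁻ y in Metric.ball x 1, ENNReal.ofReal |b t y|) < ⊤)
    (hb2 : ∀ x : EuclideanSpace ℝ (Fin d),
      (∫⁻ t in Set.Icc (0:ℝ) T,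
        (∫⁻ y in Metric.ball x 1, ENNReal.ofReal |b t y|) ^ r) < ⊤)
    (hb3 : ∀ t ∈ Set.Icc (0:ℝ) T, ∀ x : EuclideanSpace ℝ (Fin d),
      (∫⁻ y in Metric.ball x ρ₁, ∫⁻ z in Metric.ball x ρ₁,
        ENNReal.ofReal (|b t y - b t z| ^ q)) ≤ ENNReal.ofReal K) :
    ∀ R : ℝ, 0 < R →
      (∫⁻ t in Set.Icc (0:ℝ) T,
        ∫⁻ x in Metric.ball (0 : EuclideanSpace ℝ (Fin d)) R,
          ENNReal.ofReal (|b t x| ^ r)) < ⊤ := by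
  intro R _
  obtain ⟨hρ0, hρ1⟩ := hρ₁
  have hr0 : 0 ≤ r := zero_le_one.trans hr
  have hbt (t : ℝ) : Measurable (b t) := hb.comp measurable_prodMk_left
  have hmeas (s : Set (EuclideanSpace ℝ (Fin d))) :
      Measurable fun t => ∫⁻ x in s, ENNReal.ofReal (|b t x| ^ r) :=
    Measurable.lintegral_prod_right'
      (f := fun p : ℝ × EuclideanSpace ℝ (Fin d) => ENNReal.ofReal (|b p.1 p.2| ^ r))
      ((measurable_abs.comp hb).pow_const r).ennreal_ofReal
  have hlocal (x : EuclideanSpace ℝ (Fin d)) :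
      ∫⁻ t in Set.Icc (0 : ℝ) T, ∫⁻ y in Metric.ball x ρ₁, ENNReal.ofReal (|b t y| ^ r) < ⊤ := by
    set m := volume (Metric.ball x ρ₁) with hm
    have hm_top : m ≠ ⊤ := measure_ball_lt_top.ne
    have hm0 : m ≠ 0 := (Metric.measure_ball_pos volume x hρ0).ne'
    have hmr : m ^ r ≠ ⊤ := ENNReal.rpow_ne_top_of_nonneg hr0 hm_top
    have hmr' : m ^ (r - 1) ≠ ⊤ := ENNReal.rpow_ne_top_of_nonneg (by linarith) hm_top
    have h2 : (2 : ℝ≥0∞) ^ (r - 1) ≠ ⊤ :=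
      ENNReal.rpow_ne_top_of_nonneg (by linarith) ENNReal.ofNat_ne_top
    have hmr0 : m ^ r ≠ 0 := by simp [hm0, hm_top]
    have hbound : ∀ t ∈ Set.Icc (0 : ℝ) T,
        m ^ r * ∫⁻ y in Metric.ball x ρ₁, ENNReal.ofReal (|b t y| ^ r) ≤
        2 ^ (r - 1) * (m ^ (r - 1) * (m * m + ENNReal.ofReal K) +
          (∫⁻ y in Metric.ball x 1, ENNReal.ofReal |b t y|) ^ r * m) := by
      intro t ht
      have : IsFiniteMeasure (volume.restrict (Metric.ball x ρ₁)) :=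
        isFiniteMeasure_restrict.2 hm_top
      have h := measure_univ_rpow_mul_lintegral_rpow_le
        (μ := volume.restrict (Metric.ball x ρ₁)) (hbt t) hr hrq
      rw [Measure.restrict_apply_univ, ← hm] at h
      refine h.trans ?_
      gcongr
      exact hb3 t ht x
    refine ENNReal.lt_top_of_mul_ne_top_right (a := m ^ r) (ne_of_lt ?_) hmr0
    rw [← lintegral_const_mul' _ _ hmr]
    refine (setLIntegral_mono' measurableSet_Icc hbound).trans_lt ?_
    rw [lintegral_const_mul' _ _ h2, lintegral_add_left measurable_const,
      lintegral_mul_const' _ _ hm_top, setLIntegral_const, Real.volume_Icc]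
    have hx := (hb2 x).ne
    finiteness
  suffices h : ∫⁻ t in Set.Icc (0 : ℝ) T,
      ∫⁻ x in Metric.closedBall (0 : EuclideanSpace ℝ (Fin d)) R,
        ENNReal.ofReal (|b t x| ^ r) < ⊤ from
    (lintegral_mono fun t => lintegral_mono_set Metric.ball_subset_closedBall).trans_lt h
  refine (isCompact_closedBall (0 : EuclideanSpace ℝ (Fin d)) R).induction_on
    (p := fun s => ∫⁻ t in Set.Icc (0 : ℝ) T, ∫⁻ x in s, ENNReal.ofReal (|b t x| ^ r) < ⊤)
    (by simp) (fun s s' hss' h => (lintegral_mono fun t => lintegral_mono_set hss').trans_lt h)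
    (fun s s' hs hs' => ?_) fun x _ =>
      ⟨Metric.ball x ρ₁, mem_nhdsWithin_of_mem_nhds (Metric.ball_mem_nhds x hρ0), hlocal x⟩
  refine (lintegral_mono fun t => lintegral_union_le _ s s').trans_lt ?_
  rw [lintegral_add_left (hmeas s)]
  exact ENNReal.add_lt_top.2 ⟨hs, hs'⟩
end

section
/- Let d ≥ 1, m ≥ 0, K ≥ 0, and define ψ : ℝ^d → ℝ by ψ(z) = (1 + |z|²)^{−m}. Let a : ℝ^d → Matrix (Fin d) (Fin d) ℝ and b : ℝ^d → ℝ^d be functions satisfying |a^{ij}(z)| ≤ K for all i, j and |b(z)| ≤ K (1 + |z|) for all z ∈ ℝ^d. Then there exists a constant N₀ ≥ 0, depending only on d, m, K, such that for all z ∈ ℝ^d: Σ_{i,j=1}^d a^{ij}(z) ∂²ψ/∂z^i∂z^j (z) + Σ_{i=1}^d b^i(z) ∂ψ/∂z^i (z) ≤ N₀ ψ(z). -/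
section JapaneseBracket

variable {E : Type*} [NormedAddCommGroup E] [InnerProductSpace ℝ E]

theorem hasFDerivAt_one_add_norm_sq_rpow (p : ℝ) (z : E) :
    HasFDerivAt (fun u : E => (1 + ‖u‖ ^ 2) ^ p)
      ((2 * p * (1 + ‖z‖ ^ 2) ^ (p - 1)) • innerSL ℝ z) z := by
  have h : HasFDerivAt (fun u : E => 1 + ‖u‖ ^ 2) (2 • innerSL ℝ z) z :=
    (hasStrictFDerivAt_norm_sq z).hasFDerivAt.const_add 1
  have hpos : 1 + ‖z‖ ^ 2 ≠ 0 := by positivity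
  convert h.rpow_const (p := p) (Or.inl hpos) using 1
  ext v
  simp
  ring

theorem fderiv_one_add_norm_sq_rpow_apply (p : ℝ) (z v : E) :
    fderiv ℝ (fun u : E => (1 + ‖u‖ ^ 2) ^ p) z v =
      2 * p * ((1 + ‖z‖ ^ 2) ^ (p - 1) * inner ℝ z v) := by
  rw [(hasFDerivAt_one_add_norm_sq_rpow p z).fderiv]
  simp
  ring

theorem fderiv_fderiv_one_add_norm_sq_rpow_apply (p : ℝ) (z v w : E) :
    fderiv ℝ (fun y => fderiv ℝ (fun u : E => (1 + ‖u‖ ^ 2) ^ p) y v) z w =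
      2 * p * ((1 + ‖z‖ ^ 2) ^ (p - 1) * inner ℝ v w +
        2 * (p - 1) * (1 + ‖z‖ ^ 2) ^ (p - 2) * (inner ℝ z v * inner ℝ z w)) := by
  simp only [fderiv_one_add_norm_sq_rpow_apply]
  have h₁ := hasFDerivAt_one_add_norm_sq_rpow (p - 1) z
  have h₂ : HasFDerivAt (fun y : E => inner ℝ y v) (innerSL ℝ v) z :=
    (innerSL ℝ v).hasFDerivAt.congr_of_eventuallyEq (.of_forall fun y => real_inner_comm v y)
  have h₃ : HasFDerivAt
      (fun y : E => 2 * p * ((1 + ‖y‖ ^ 2) ^ (p - 1) * inner ℝ y v)) _ z :=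
    (h₁.mul h₂).const_mul (2 * p)
  rw [h₃.fderiv, show p - 2 = p - 1 - 1 by ring]
  simp
  ring

theorem abs_fderiv_one_add_norm_sq_rpow_apply_le (p : ℝ) (z v : E) :
    (1 + ‖z‖) * |fderiv ℝ (fun u : E => (1 + ‖u‖ ^ 2) ^ p) z v| ≤
      4 * |p| * ‖v‖ * (1 + ‖z‖ ^ 2) ^ p := by
  have hpos : 0 < 1 + ‖z‖ ^ 2 := by positivity
  have hp : (1 + ‖z‖ ^ 2) ^ p = (1 + ‖z‖ ^ 2) ^ (p - 1) * (1 + ‖z‖ ^ 2) := by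
    rw [Real.rpow_sub_one hpos.ne']
    field_simp
  have hQ : 0 < (1 + ‖z‖ ^ 2) ^ (p - 1) := Real.rpow_pos_of_pos hpos _
  rw [fderiv_one_add_norm_sq_rpow_apply, hp, abs_mul, abs_mul, abs_mul, abs_two, abs_of_pos hQ]
  set Q := (1 + ‖z‖ ^ 2) ^ (p - 1)
  calc (1 + ‖z‖) * (2 * |p| * (Q * |inner ℝ z v|))
      ≤ (1 + ‖z‖) * (2 * |p| * (Q * (‖z‖ * ‖v‖))) := by
        gcongr
        exact abs_real_inner_le_norm z v
    _ = 2 * |p| * ‖v‖ * Q * ((1 + ‖z‖) * ‖z‖) := by ring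
    _ ≤ 2 * |p| * ‖v‖ * Q * (2 * (1 + ‖z‖ ^ 2)) := by
        refine mul_le_mul_of_nonneg_left ?_ (by positivity)
        nlinarith [sq_nonneg (‖z‖ - 1)]
    _ = 4 * |p| * ‖v‖ * (Q * (1 + ‖z‖ ^ 2)) := by ring

theorem abs_fderiv_fderiv_one_add_norm_sq_rpow_apply_le (p : ℝ) (z v w : E) :
    |fderiv ℝ (fun y => fderiv ℝ (fun u : E => (1 + ‖u‖ ^ 2) ^ p) y v) z w| ≤
      2 * |p| * (1 + 2 * |p - 1|) * (‖v‖ * ‖w‖) * (1 + ‖z‖ ^ 2) ^ p := by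
  have hone : 1 ≤ 1 + ‖z‖ ^ 2 := by nlinarith [sq_nonneg ‖z‖]
  have hpos : 0 < 1 + ‖z‖ ^ 2 := by positivity
  have hp : (1 + ‖z‖ ^ 2) ^ (p - 1) = (1 + ‖z‖ ^ 2) ^ (p - 2) * (1 + ‖z‖ ^ 2) := by
    rw [show p - 2 = p - 1 - 1 by ring, Real.rpow_sub_one hpos.ne' (p - 1)]
    field_simp
  have hle : (1 + ‖z‖ ^ 2) ^ (p - 1) ≤ (1 + ‖z‖ ^ 2) ^ p :=
    Real.rpow_le_rpow_of_exponent_le hone (by linarith)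
  have hR : 0 < (1 + ‖z‖ ^ 2) ^ (p - 2) := Real.rpow_pos_of_pos hpos _
  have hQ : 0 < (1 + ‖z‖ ^ 2) ^ (p - 1) := Real.rpow_pos_of_pos hpos _
  have hsq : (1 + ‖z‖ ^ 2) ^ (p - 2) * ‖z‖ ^ 2 ≤ (1 + ‖z‖ ^ 2) ^ (p - 1) := by
    rw [hp]
    gcongr
    linarith
  rw [fderiv_fderiv_one_add_norm_sq_rpow_apply]
  set R := (1 + ‖z‖ ^ 2) ^ (p - 2)
  set Q := (1 + ‖z‖ ^ 2) ^ (p - 1)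
  set P := (1 + ‖z‖ ^ 2) ^ p
  calc |2 * p * (Q * inner ℝ v w + 2 * (p - 1) * R * (inner ℝ z v * inner ℝ z w))|
      ≤ 2 * |p| * (Q * |inner ℝ v w| +
          2 * |p - 1| * R * (|inner ℝ z v| * |inner ℝ z w|)) := by
        rw [abs_mul, abs_mul, abs_two]
        gcongr
        refine (abs_add_le _ _).trans_eq ?_
        simp only [abs_mul, abs_two, abs_of_pos hQ, abs_of_pos hR]
    _ ≤ 2 * |p| * (Q * (‖v‖ * ‖w‖) +
          2 * |p - 1| * R * ((‖z‖ * ‖v‖) * (‖z‖ * ‖w‖))) := by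
        gcongr <;> exact abs_real_inner_le_norm _ _
    _ = 2 * |p| * (‖v‖ * ‖w‖) * (Q + 2 * |p - 1| * (R * ‖z‖ ^ 2)) := by ring
    _ ≤ 2 * |p| * (‖v‖ * ‖w‖) * (P + 2 * |p - 1| * P) := by
        gcongr
        exact hsq.trans hle
    _ = 2 * |p| * (1 + 2 * |p - 1|) * (‖v‖ * ‖w‖) * P := by ring

end JapaneseBracket

/-- Remark 9.20.1: for `ψ(z) = (1 + |z|²)^{−m}` there is a constant `N₀ ≥ 0`,
depending only on `d`, `m`, `K`, such that for all coefficients `a` with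
`|aⁱʲ(z)| ≤ K` and `b` with `|b(z)| ≤ K(1 + |z|)`, one has
`Σ aⁱʲ(z) ∂²ψ/∂zⁱ∂zʲ(z) + Σ bⁱ(z) ∂ψ/∂zⁱ(z) ≤ N₀ ψ(z)` for all `z`. -/
theorem stmt_13 (d : ℕ) (hd : 1 ≤ d) (m K : ℝ) (hm : 0 ≤ m) (hK : 0 ≤ K) :
    ∃ N₀ : ℝ, 0 ≤ N₀ ∧
      ∀ (a : EuclideanSpace ℝ (Fin d) → Matrix (Fin d) (Fin d) ℝ)
        (b : EuclideanSpace ℝ (Fin d) → EuclideanSpace ℝ (Fin d)),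
        (∀ z i j, |a z i j| ≤ K) →
        (∀ z, ‖b z‖ ≤ K * (1 + ‖z‖)) →
        ∀ z : EuclideanSpace ℝ (Fin d),
          (∑ i, ∑ j, a z i j *
              fderiv ℝ
                (fun w =>
                  fderiv ℝ (fun u : EuclideanSpace ℝ (Fin d) => (1 + ‖u‖ ^ 2) ^ (-m)) w
                    (EuclideanSpace.single i 1))
                z (EuclideanSpace.single j 1))
            + (∑ i, b z i *
                fderiv ℝ (fun u : EuclideanSpace ℝ (Fin d) => (1 + ‖u‖ ^ 2) ^ (-m)) z
                  (EuclideanSpace.single i 1))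
            ≤ N₀ * (1 + ‖z‖ ^ 2) ^ (-m) := by
  refine ⟨d * (d * (K * (2 * |-m| * (1 + 2 * |-m - 1|)))) + d * (K * (4 * |-m|)),
    by positivity, fun a b ha hb z => ?_⟩
  set P := (1 + ‖z‖ ^ 2) ^ (-m)
  rw [add_mul]
  refine add_le_add ?_ ?_
  · calc _ ≤ ∑ _i : Fin d, ∑ _j : Fin d, K * (2 * |-m| * (1 + 2 * |-m - 1|) * P) := by
          refine Finset.sum_le_sum fun i _ => Finset.sum_le_sum fun j _ => ?_
          refine (le_abs_self _).trans ?_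
          rw [abs_mul]
          refine mul_le_mul (ha z i j) ?_ (abs_nonneg _) hK
          simpa using abs_fderiv_fderiv_one_add_norm_sq_rpow_apply_le (-m) z
            (EuclideanSpace.single i (1 : ℝ)) (EuclideanSpace.single j 1)
      _ = _ := by
          simp only [Finset.sum_const, Finset.card_univ, Fintype.card_fin, nsmul_eq_mul]
          ring
  · calc _ ≤ ∑ _i : Fin d, K * (4 * |-m| * P) := by
          refine Finset.sum_le_sum fun i _ => (le_abs_self _).trans ?_
          have hbi : |b z i| ≤ K * (1 + ‖z‖) := (PiLp.norm_apply_le (b z) i).trans (hb z)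
          have hD := abs_fderiv_one_add_norm_sq_rpow_apply_le (-m) z
            (EuclideanSpace.single i (1 : ℝ))
          rw [PiLp.norm_single, norm_one, mul_one] at hD
          rw [abs_mul]
          refine (mul_le_mul_of_nonneg_right hbi (abs_nonneg _)).trans ?_
          rw [mul_assoc]
          exact mul_le_mul_of_nonneg_left hD hK
      _ = _ := by
          simp only [Finset.sum_const, Finset.card_univ, Fintype.card_fin, nsmul_eq_mul]
          ring
end
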